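/- Fix n ≥ 2. Let Art(Ã_n) be the group presented by generators t_i indexed by i ∈ ℤ/(n+1) with relations: t_it_{i+1}t_i = t_{i+1}t_it_{i+1} for each i ∈ ℤ/(n+1), and t_it_j = t_jt_i whenever j ≠ i ± 1 in ℤ/(n+1). Then Art(Ã_n) is torsion-free: its only element of finite order is the identity. -/

import Mathlib

/-- The standard presentation relations for the euclidean Artin group `Art(Ã_n)`
on generators `t_i`, `i ∈ ℤ/(n+1)`:  `t_it_{i+1}t_i = t_{i+1}t_it_{i+1}` for each
`i`, and `t_it_j = t_jt_i` whenever `j ≠ i ± 1`. -/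
def relsArtinAtilde (n : ℕ) : Set (FreeGroup (ZMod (n + 1))) :=
  {x | ∃ i : ZMod (n + 1),
      x = FreeGroup.of i * FreeGroup.of (i + 1) * FreeGroup.of i *
        (FreeGroup.of (i + 1) * FreeGroup.of i * FreeGroup.of (i + 1))⁻¹} ∪
  {x | ∃ i j : ZMod (n + 1), j ≠ i + 1 ∧ j ≠ i - 1 ∧
      x = FreeGroup.of i * FreeGroup.of j * (FreeGroup.of j * FreeGroup.of i)⁻¹}

/-- The relations of the small-type Artin monoid of a simple graph: adjacent generators satisfy the
braid relation, the other pairs commute. -/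
inductive ArtinRel {S : Type*} (Γ : SimpleGraph S) : FreeMonoid S → FreeMonoid S → Prop
  | braid {s t : S} (h : Γ.Adj s t) : ArtinRel Γ
      (FreeMonoid.of s * FreeMonoid.of t * FreeMonoid.of s)
      (FreeMonoid.of t * FreeMonoid.of s * FreeMonoid.of t)
  | comm {s t : S} (h : ¬ Γ.Adj s t) : ArtinRel Γ
      (FreeMonoid.of s * FreeMonoid.of t) (FreeMonoid.of t * FreeMonoid.of s)

/-- The small-type Artin monoid of a simple graph. -/
abbrev ArtinMonoid {S : Type*} (Γ : SimpleGraph S) : Type _ := PresentedMonoid (ArtinRel Γ)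

namespace ArtinMonoid

variable {S : Type*} {Γ : SimpleGraph S}

/-- The standard generators of the Artin monoid. -/
abbrev gen (Γ : SimpleGraph S) (s : S) : ArtinMonoid Γ := PresentedMonoid.of (ArtinRel Γ) s

theorem gen_braid {s t : S} (h : Γ.Adj s t) :
    gen Γ s * gen Γ t * gen Γ s = gen Γ t * gen Γ s * gen Γ t :=
  PresentedMonoid.mk_eq_mk_of_rel (.braid h)

theorem gen_comm {s t : S} (h : ¬ Γ.Adj s t) : gen Γ s * gen Γ t = gen Γ t * gen Γ s :=
  PresentedMonoid.mk_eq_mk_of_rel (.comm h)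

theorem gen_braid_mul {s t : S} (h : Γ.Adj s t) (x : ArtinMonoid Γ) :
    gen Γ s * (gen Γ t * (gen Γ s * x)) = gen Γ t * (gen Γ s * (gen Γ t * x)) := by
  simp only [← mul_assoc, gen_braid h]

theorem gen_comm_mul {s t : S} (h : ¬ Γ.Adj s t) (x : ArtinMonoid Γ) :
    gen Γ s * (gen Γ t * x) = gen Γ t * (gen Γ s * x) := by
  simp only [← mul_assoc, gen_comm h]

/-- The length homomorphism, in multiplicative notation. -/
def lengthHom (Γ : SimpleGraph S) : ArtinMonoid Γ →* Multiplicative ℕ :=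
  PresentedMonoid.lift (fun _ => Multiplicative.ofAdd 1) (by rintro _ _ (h | h) <;> rfl)

/-- The word length of an element. -/
def length (x : ArtinMonoid Γ) : ℕ := (lengthHom Γ x).toAdd

@[simp] theorem length_one : length (1 : ArtinMonoid Γ) = 0 := by simp [length]

@[simp] theorem length_mul (x y : ArtinMonoid Γ) : length (x * y) = length x + length y := by
  simp [length]

@[simp] theorem length_gen (s : S) : length (gen Γ s) = 1 := rfl

theorem length_mk (u : FreeMonoid S) :
    length (PresentedMonoid.mk (ArtinRel Γ) u) = FreeMonoid.length u := by
  induction u with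
  | one => exact length_one
  | of s => rfl
  | mul u v hu hv => rw [map_mul, length_mul, hu, hv, FreeMonoid.length_mul]

theorem eq_one_or_exists_gen_mul (x : ArtinMonoid Γ) : x = 1 ∨ ∃ s y, x = gen Γ s * y := by
  obtain ⟨u, rfl⟩ := PresentedMonoid.surjective_mk x
  cases u using FreeMonoid.casesOn with
  | one => exact Or.inl rfl
  | of_mul s u => exact Or.inr ⟨s, PresentedMonoid.mk _ u, rfl⟩

theorem eq_one_of_length_eq_zero {x : ArtinMonoid Γ} (h : length x = 0) : x = 1 := by
  obtain rfl | ⟨s, y, rfl⟩ := eq_one_or_exists_gen_mul x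
  · rfl
  · simp at h

/-- `Completes s t a b` says that `(a, b)` is a right multiple of the pair of minimal complements
of `s` and `t`, so that `s * a = t * b` is a multiple of the least common multiple of `s`, `t`. -/
inductive Completes (Γ : SimpleGraph S) (s t : S) (a b : ArtinMonoid Γ) : Prop
  | same (h : s = t) (hab : a = b)
  | braid (h : Γ.Adj s t) (c : ArtinMonoid Γ) (ha : a = gen Γ t * (gen Γ s * c))
      (hb : b = gen Γ s * (gen Γ t * c))
  | comm (hne : s ≠ t) (h : ¬ Γ.Adj s t) (c : ArtinMonoid Γ) (ha : a = gen Γ t * c)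
      (hb : b = gen Γ s * c)

namespace Completes

variable {s t r : S} {a b d : ArtinMonoid Γ}

theorem symm (h : Completes Γ s t a b) : Completes Γ t s b a := by
  cases h with
  | same h hab => exact .same h.symm hab.symm
  | braid h c ha hb => exact .braid h.symm c hb ha
  | comm hne h c ha hb => exact .comm hne.symm (fun h' => h h'.symm) c hb ha

theorem mul_right (h : Completes Γ s t a b) (x : ArtinMonoid Γ) :
    Completes Γ s t (a * x) (b * x) := by
  cases h with
  | same h hab => exact .same h (by rw [hab])
  | braid h c ha hb =>
    exact .braid h (c * x) (by simp only [ha, mul_assoc]) (by simp only [hb, mul_assoc])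
  | comm hne h c ha hb =>
    exact .comm hne h (c * x) (by simp only [ha, mul_assoc]) (by simp only [hb, mul_assoc])

theorem eq (h : Completes Γ s s a b) : a = b := by
  cases h with
  | same h hab => exact hab
  | braid h c ha hb => exact absurd h (Γ.irrefl)
  | comm hne h c ha hb => exact absurd rfl hne

theorem eq_mul_comm (h : Completes Γ s t a b) (hne : s ≠ t) (hst : ¬ Γ.Adj s t) :
    ∃ c, a = gen Γ t * c ∧ b = gen Γ s * c := by
  cases h with
  | same h hab => exact absurd h hne
  | braid h c ha hb => exact absurd h hst
  | comm hne h c ha hb => exact ⟨c, ha, hb⟩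

theorem eq_mul_braid (h : Completes Γ s t a b) (hst : Γ.Adj s t) :
    ∃ c, a = gen Γ t * (gen Γ s * c) ∧ b = gen Γ s * (gen Γ t * c) := by
  cases h with
  | same h hab => exact absurd h hst.ne
  | braid h c ha hb => exact ⟨c, ha, hb⟩
  | comm hne h c ha hb => exact absurd hst h

/-- Transitivity through a braid relation on the left and a commutation on the right. -/
theorem trans_braid_comm {N : ℕ}
    (ih : ∀ (s t : S) (a b : ArtinMonoid Γ), length a < N → gen Γ s * a = gen Γ t * b →
      Completes Γ s t a b)
    (hsr : Γ.Adj s r) (hrt : ¬ Γ.Adj r t) (hne : r ≠ t) {c e : ArtinMonoid Γ}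
    (hN : length d ≤ N) (hd : d = gen Γ s * (gen Γ r * c)) (hd' : d = gen Γ t * e) :
    Completes Γ s t (gen Γ r * (gen Γ s * c)) (gen Γ r * e) := by
  have hlen : length c + 2 ≤ N := by
    rw [hd] at hN; simp only [length_mul, length_gen] at hN; omega
  have hst : s ≠ t := by rintro rfl; exact hrt hsr.symm
  by_cases hadj : Γ.Adj s t
  · obtain ⟨g, hg, rfl⟩ := (ih s t (gen Γ r * c) e (by simp; omega) (hd ▸ hd')).eq_mul_braid hadj
    obtain ⟨h, rfl, hh⟩ := (ih r t _ _ (by omega) hg).eq_mul_comm hne hrt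
    have hlen' : length (gen Γ s * g) < N := by rw [hh]; simp at hlen ⊢; omega
    obtain ⟨k, rfl, rfl⟩ := (ih s r _ _ (by simp at hlen'; omega) hh).eq_mul_braid hsr
    refine .braid hadj (gen Γ r * (gen Γ s * (gen Γ t * k))) ?_ ?_
    · rw [gen_braid_mul hadj, ← gen_comm_mul hrt k, gen_braid_mul hsr,
        ← gen_comm_mul hrt (gen Γ s * _)]
    · rw [← gen_comm_mul hrt, gen_braid_mul hsr.symm, gen_braid_mul hadj, gen_comm_mul hrt]
  · obtain ⟨g, hg, rfl⟩ := (ih s t (gen Γ r * c) e (by simp; omega) (hd ▸ hd')).eq_mul_comm hst hadj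
    obtain ⟨h, rfl, rfl⟩ := (ih r t _ _ (by omega) hg).eq_mul_comm hne hrt
    refine .comm hst hadj (gen Γ r * (gen Γ s * h)) ?_ ?_
    · rw [gen_comm_mul hadj, gen_comm_mul hrt]
    · rw [gen_braid_mul hsr.symm]

theorem trans {N : ℕ} (hΓ : ∀ s t r, Γ.Adj s t → Γ.Adj t r → ¬ Γ.Adj s r)
    (ih : ∀ (s t : S) (a b : ArtinMonoid Γ), length a < N → gen Γ s * a = gen Γ t * b →
      Completes Γ s t a b)
    (h₁ : Completes Γ s r a d) (h₂ : Completes Γ r t d b) (hN : length d ≤ N) :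
    Completes Γ s t a b := by
  cases h₁ with
  | same h hab => subst h hab; exact h₂
  | braid hsr c ha hd =>
    cases h₂ with
    | same h hab => subst h hab; exact .braid hsr c ha hd
    | braid hrt e hd' hb =>
      subst ha hb
      have hlen : length c + 2 ≤ N := by
        rw [hd] at hN; simp only [length_mul, length_gen] at hN; omega
      have hce := ih s t (gen Γ r * c) (gen Γ r * e) (by simp; omega) (hd ▸ hd')
      by_cases hst : s = t
      · subst hst
        rw [(ih r r _ _ (by omega) hce.eq).eq]
        exact .same rfl rfl
      have hadj : ¬ Γ.Adj s t := hΓ _ _ _ hsr hrt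
      obtain ⟨g, hg, hg'⟩ := hce.eq_mul_comm hst hadj
      obtain ⟨h, rfl, rfl⟩ := (ih r t _ _ (by omega) hg).eq_mul_braid hrt
      have hlen' : length e + 2 ≤ N := by
        rw [hd'] at hN; simp only [length_mul, length_gen] at hN; omega
      obtain ⟨h', rfl, hh⟩ := (ih r s _ _ (by omega) hg').eq_mul_braid hsr.symm
      simp only [length_mul, length_gen] at hlen hlen'
      have hh := (ih r r _ _ (by simp; omega) hh).eq
      obtain ⟨k, rfl, rfl⟩ := (ih t s _ _ (by omega) hh).eq_mul_comm (Ne.symm hst)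
        (fun h => hadj h.symm)
      refine .comm hst hadj (gen Γ r * (gen Γ t * (gen Γ s * (gen Γ r * k)))) ?_ ?_
      · rw [gen_comm_mul hadj, gen_braid_mul hsr, gen_braid_mul hrt]
      · rw [← gen_comm_mul hadj, ← gen_braid_mul hrt, gen_braid_mul hsr.symm, gen_comm_mul hadj]
    | comm hne hrt e hd' hb =>
      subst ha hb
      exact trans_braid_comm ih hsr hrt hne hN hd hd'
  | comm hne hsr c ha hd =>
    cases h₂ with
    | same h hab => subst h hab; exact .comm hne hsr c ha hd
    | braid hrt e hd' hb =>
      subst ha hb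
      exact (trans_braid_comm ih hrt.symm (fun h => hsr h.symm) hne.symm hN hd' hd).symm
    | comm hne' hrt e hd' hb =>
      subst ha hb
      have hlen : length c + 1 ≤ N := by
        rw [hd] at hN; simp only [length_mul, length_gen] at hN; omega
      have hce := ih s t c e (by omega) (hd ▸ hd')
      have hrs : ¬ Γ.Adj r s := fun h => hsr h.symm
      cases hce with
      | same h hab => subst h hab; exact .same rfl rfl
      | braid h g hc he =>
        refine .braid h (gen Γ r * g) ?_ ?_
        · rw [hc, gen_comm_mul hrt, gen_comm_mul hrs]
        · rw [he, gen_comm_mul hrs, gen_comm_mul hrt]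
      | comm hne h g hc he =>
        refine .comm hne h (gen Γ r * g) ?_ ?_
        · rw [hc, gen_comm_mul hrt]
        · rw [he, gen_comm_mul hrs]

end Completes

/-- Garside's key lemma. -/
theorem completes_of_mul_eq (hΓ : ∀ s t r, Γ.Adj s t → Γ.Adj t r → ¬ Γ.Adj s r) (N : ℕ) :
    ∀ (s t : S) (a b : ArtinMonoid Γ), length a < N → gen Γ s * a = gen Γ t * b →
      Completes Γ s t a b := by
  induction N with
  | zero => intro _ _ _ _ h; omega
  | succ N ih =>
    have key : ∀ u v : FreeMonoid S, ConGen.Rel (ArtinRel Γ) u v → FreeMonoid.length u ≤ N + 1 →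
        (u = 1 ∧ v = 1) ∨ ∃ s u' t v', u = .of s * u' ∧ v = .of t * v' ∧
          Completes Γ s t (.mk _ u') (.mk _ v') := by
      intro u v h
      have hlen : ∀ {u v : FreeMonoid S}, ConGen.Rel (ArtinRel Γ) u v →
          FreeMonoid.length u = FreeMonoid.length v := by
        intro u v h
        rw [← length_mk (Γ := Γ), ← length_mk (Γ := Γ), PresentedMonoid.mk_eq_mk_iff.2 h]
      induction h with
      | of x y h =>
        intro _
        cases h with
        | braid h => exact .inr ⟨_, _, _, _, rfl, rfl, .braid h 1 rfl rfl⟩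
        | @comm s t h =>
          by_cases hst : s = t
          · subst hst; exact .inr ⟨_, _, _, _, rfl, rfl, .same rfl rfl⟩
          · exact .inr ⟨_, _, _, _, rfl, rfl, .comm hst h 1 rfl rfl⟩
      | refl x =>
        intro _
        cases x using FreeMonoid.casesOn with
        | one => exact .inl ⟨rfl, rfl⟩
        | of_mul s u => exact .inr ⟨_, _, _, _, rfl, rfl, .same rfl rfl⟩
      | symm h ihh =>
        intro hl
        obtain ⟨h1, h2⟩ | ⟨s, u', t, v', h1, h2, h3⟩ := ihh (by rwa [hlen h])
        · exact .inl ⟨h2, h1⟩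
        · exact .inr ⟨_, _, _, _, h2, h1, h3.symm⟩
      | trans h h' ih1 ih2 =>
        intro hl
        obtain ⟨rfl, rfl⟩ | ⟨s, u', t, v', rfl, rfl, h3⟩ := ih1 hl
        · exact ih2 (by simp)
        · obtain ⟨h1, -⟩ | ⟨s', u'', t', v'', h1, rfl, h3'⟩ := ih2 (by rwa [← hlen h])
          · exact absurd h1 (by simp [← FreeMonoid.toList.injective.eq_iff])
          · obtain ⟨rfl, rfl⟩ : t = s' ∧ v' = u'' := by
              rw [← FreeMonoid.toList.injective.eq_iff] at h1
              simpa using h1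
            refine .inr ⟨_, _, _, _, rfl, rfl, h3.trans hΓ ih h3' ?_⟩
            rw [length_mk]
            have := hlen h
            simp at this hl
            omega
      | @mul w x y z h h' ih1 ih2 =>
        intro hl
        rw [FreeMonoid.length_mul] at hl
        obtain ⟨rfl, rfl⟩ | ⟨s, u', t, v', rfl, rfl, h3⟩ := ih1 (by omega)
        · simpa using ih2 (by omega)
        · refine .inr ⟨s, u' * y, t, v' * z, mul_assoc _ _ _, mul_assoc _ _ _, ?_⟩
          have hyz := PresentedMonoid.mk_eq_mk_iff.2 h'
          rw [map_mul, map_mul, hyz]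
          exact h3.mul_right _
    intro s t a b hl hab
    obtain ⟨u, rfl⟩ := PresentedMonoid.surjective_mk a
    obtain ⟨v, rfl⟩ := PresentedMonoid.surjective_mk b
    rw [length_mk] at hl
    have hab' : PresentedMonoid.mk (ArtinRel Γ) (.of s * u) = .mk _ (.of t * v) := hab
    obtain ⟨h1, -⟩ | ⟨s', u', t', v', h1, h2, h3⟩ :=
      key (.of s * u) (.of t * v) (PresentedMonoid.mk_eq_mk_iff.1 hab') (by simp; omega)
    · exact absurd h1 (by simp [← FreeMonoid.toList.injective.eq_iff])
    · rw [← FreeMonoid.toList.injective.eq_iff] at h1 h2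
      simp at h1 h2
      rw [h1.1, h1.2, h2.1, h2.2]
      exact h3

end ArtinMonoid

namespace ArtinMonoid

variable {S : Type*} {Γ : SimpleGraph S}

theorem mul_left_cancel_of_triangleFree (hΓ : ∀ s t r, Γ.Adj s t → Γ.Adj t r → ¬ Γ.Adj s r)
    {x a b : ArtinMonoid Γ} (h : x * a = x * b) : a = b := by
  obtain ⟨u, rfl⟩ := PresentedMonoid.surjective_mk x
  induction u using FreeMonoid.inductionOn' with
  | one => simpa using h
  | of_mul s u ih =>
    rw [map_mul, mul_assoc, mul_assoc] at h
    exact ih (completes_of_mul_eq hΓ _ s s _ _ (Nat.lt_succ_self _) h).eq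

theorem mul_dvd_mul_iff_of_triangleFree (hΓ : ∀ s t r, Γ.Adj s t → Γ.Adj t r → ¬ Γ.Adj s r)
    {x a b : ArtinMonoid Γ} : x * a ∣ x * b ↔ a ∣ b := by
  constructor
  · rintro ⟨c, hc⟩
    rw [mul_assoc] at hc
    exact ⟨c, mul_left_cancel_of_triangleFree hΓ hc⟩
  · exact mul_dvd_mul_left x

/-- `l` is a least common right multiple of `a` and `b`. -/
def IsLcm (a b l : ArtinMonoid Γ) : Prop := ∀ x, l ∣ x ↔ a ∣ x ∧ b ∣ x

theorem exists_isLcm_gen (hΓ : ∀ s t r, Γ.Adj s t → Γ.Adj t r → ¬ Γ.Adj s r) (s t : S) :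
    ∃ f : ArtinMonoid Γ, ∀ x, gen Γ t ∣ gen Γ s * x ↔ f ∣ x := by
  by_cases hst : s = t
  · exact ⟨1, fun x => by simp [hst]⟩
  by_cases hadj : Γ.Adj s t
  · refine ⟨gen Γ t * gen Γ s, fun x => ⟨?_, ?_⟩⟩
    · rintro ⟨y, hy⟩
      obtain ⟨c, hc, -⟩ := (completes_of_mul_eq hΓ _ s t _ _ (Nat.lt_succ_self _)
        hy).eq_mul_braid hadj
      exact ⟨c, by rw [hc, mul_assoc]⟩
    · rintro ⟨c, rfl⟩
      exact ⟨gen Γ s * (gen Γ t * c), by rw [mul_assoc, gen_braid_mul hadj]⟩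
  · refine ⟨gen Γ t, fun x => ⟨?_, ?_⟩⟩
    · rintro ⟨y, hy⟩
      obtain ⟨c, hc, -⟩ := (completes_of_mul_eq hΓ _ s t _ _ (Nat.lt_succ_self _)
        hy).eq_mul_comm hst hadj
      exact ⟨c, hc⟩
    · rintro ⟨c, rfl⟩
      exact ⟨gen Γ s * c, by rw [gen_comm_mul hadj]⟩

theorem exists_isLcm (hΓ : ∀ s t r, Γ.Adj s t → Γ.Adj t r → ¬ Γ.Adj s r) (N : ℕ) :
    ∀ {a b m : ArtinMonoid Γ}, length m < N → a ∣ m → b ∣ m → ∃ l, IsLcm a b l := by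
  induction N with
  | zero => intro _ _ _ h; omega
  | succ N ih =>
    intro a b m hm ha hb
    obtain rfl | ⟨s, a, rfl⟩ := eq_one_or_exists_gen_mul a
    · exact ⟨b, fun x => by simp⟩
    obtain rfl | ⟨t, b, rfl⟩ := eq_one_or_exists_gen_mul b
    · exact ⟨gen Γ s * a, fun x => by simp⟩
    obtain ⟨f, hf⟩ := exists_isLcm_gen hΓ s t
    obtain ⟨m₁, rfl⟩ := (dvd_mul_right _ _).trans ha
    obtain ⟨m₂, hm₂⟩ := (dvd_mul_right _ _).trans hb
    have hlen : length (gen Γ s * m₁) = length (gen Γ t * m₂) := by rw [hm₂]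
    simp only [length_mul, length_gen] at hm hlen
    rw [mul_dvd_mul_iff_of_triangleFree hΓ] at ha
    have hfm := (hf m₁).1 ((dvd_mul_right _ _).trans hb)
    rw [hm₂, mul_dvd_mul_iff_of_triangleFree hΓ] at hb
    obtain ⟨l, hl⟩ := ih (by omega) ha hfm
    obtain ⟨w, hw⟩ := (hf l).2 ((hl l).1 dvd_rfl).2
    have hsl : ∀ x, gen Γ s * l ∣ x ↔ gen Γ s * a ∣ x ∧ gen Γ t ∣ x := by
      intro x
      constructor
      · intro h
        exact ⟨(mul_dvd_mul_left _ ((hl l).1 dvd_rfl).1).trans h,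
          ((hf l).2 ((hl l).1 dvd_rfl).2).trans h⟩
      · rintro ⟨h, h'⟩
        obtain ⟨y, rfl⟩ := (dvd_mul_right _ _).trans h
        rw [mul_dvd_mul_iff_of_triangleFree hΓ] at h ⊢
        exact (hl y).2 ⟨h, (hf y).1 h'⟩
    have hwm : w ∣ m₂ := by
      rw [← mul_dvd_mul_iff_of_triangleFree hΓ (x := gen Γ t), ← hw, ← hm₂]
      exact mul_dvd_mul_left _ ((hl m₁).2 ⟨ha, hfm⟩)
    obtain ⟨k, hk⟩ := ih (by omega) hwm hb
    refine ⟨gen Γ t * k, fun x => ⟨fun h => ?_, ?_⟩⟩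
    · obtain ⟨h1, h2⟩ := (hk k).1 dvd_rfl
      refine ⟨((hsl x).1 ?_).1, (mul_dvd_mul_left _ h2).trans h⟩
      rw [hw]
      exact (mul_dvd_mul_left _ h1).trans h
    · rintro ⟨h1, h2⟩
      have h3 := (hsl x).2 ⟨h1, (dvd_mul_right _ _).trans h2⟩
      obtain ⟨y, rfl⟩ := (dvd_mul_right _ _).trans h2
      rw [hw] at h3
      rw [mul_dvd_mul_iff_of_triangleFree hΓ] at h2 h3 ⊢
      exact (hk y).2 ⟨h3, h2⟩

/-- A Garside element: central, and a multiple of every generator. -/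
structure IsGarside (z : ArtinMonoid Γ) : Prop where
  comm : ∀ x, z * x = x * z
  gen_dvd : ∀ s, gen Γ s ∣ z

theorem IsGarside.dvd_pow {z : ArtinMonoid Γ} (hz : IsGarside z) (x : ArtinMonoid Γ) :
    ∃ n : ℕ, x ∣ z ^ n := by
  obtain ⟨u, rfl⟩ := PresentedMonoid.surjective_mk x
  induction u using FreeMonoid.inductionOn' with
  | one => exact ⟨0, by simp⟩
  | of_mul s u ih =>
    obtain ⟨n, c, hc⟩ := ih
    obtain ⟨d, hd⟩ := hz.gen_dvd s
    refine ⟨n + 1, c * d, ?_⟩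
    rw [map_mul, mul_assoc, ← mul_assoc _ c, ← hc, ← mul_assoc,
      (Commute.pow_left (hz.comm _) n : Commute (z ^ n) _).symm.eq, mul_assoc, pow_succ, hd]
    rfl

theorem exists_finite_lcm (hΓ : ∀ s t r, Γ.Adj s t → Γ.Adj t r → ¬ Γ.Adj s r)
    {z : ArtinMonoid Γ} (hz : IsGarside z) (p : ℕ → ArtinMonoid Γ) (n : ℕ) :
    ∃ h, ∀ x, h ∣ x ↔ ∀ i < n, p i ∣ x := by
  induction n with
  | zero => exact ⟨1, by simp⟩
  | succ n ih =>
    obtain ⟨h, hh⟩ := ih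
    obtain ⟨i, hi⟩ := hz.dvd_pow h
    obtain ⟨j, hj⟩ := hz.dvd_pow (p n)
    obtain ⟨l, hl⟩ := exists_isLcm hΓ _ (Nat.lt_succ_self _) (m := z ^ (i + j))
      (hi.trans (pow_dvd_pow z (by omega))) (hj.trans (pow_dvd_pow z (by omega)))
    refine ⟨l, fun x => ?_⟩
    rw [hl, hh]
    constructor
    · rintro ⟨h1, h2⟩ i hi
      obtain hi | rfl := Nat.lt_succ_iff_lt_or_eq.1 hi
      exacts [h1 i hi, h2]
    · exact fun h => ⟨fun i hi => h i (by omega), h n (by omega)⟩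

theorem exists_mul_eq_of_pow_eq (hΓ : ∀ s t r, Γ.Adj s t → Γ.Adj t r → ¬ Γ.Adj s r)
    {z : ArtinMonoid Γ} (hz : IsGarside z) {q w : ArtinMonoid Γ} (hw : ∀ x, w * x = x * w)
    {n : ℕ} (hn : 0 < n) (h : q ^ n = w ^ n) : ∃ x, q * x = w * x := by
  have hlen : length q = length w := by
    have := congrArg (fun x => (lengthHom Γ x).toAdd) h
    simp only [map_pow, toAdd_pow, smul_eq_mul, mul_right_inj' hn.ne'] at this
    exact this
  have hp : ∀ i < n, q * (q ^ i * w ^ (n - i)) = w * (q ^ (i + 1) * w ^ (n - (i + 1))) := by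
    intro i hi
    obtain ⟨k, rfl⟩ : ∃ k, n = i + 1 + k := ⟨n - (i + 1), by omega⟩
    rw [show i + 1 + k - i = k + 1 by omega, show i + 1 + k - (i + 1) = k by omega,
      ← mul_assoc q, ← pow_succ', hw, pow_succ w, mul_assoc]
  obtain ⟨l, hl⟩ := exists_finite_lcm hΓ hz (fun i => q ^ i * w ^ (n - i)) n
  have hpl := (hl l).1 dvd_rfl
  have hdvd : ∀ i < n, w * (q ^ (i + 1) * w ^ (n - (i + 1))) ∣ q * l := fun i hi => by
    rw [← hp i hi]
    exact mul_dvd_mul_left q (hpl i hi)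
  obtain ⟨y, hy⟩ := (dvd_mul_right _ _).trans (hdvd 0 hn)
  have hly : l ∣ y := by
    rw [hl]
    intro i hi
    have hi' : q ^ i * w ^ (n - i) = q ^ (n - 1 + 1) * w ^ (n - (n - 1 + 1)) ∨ 0 < i := by
      obtain rfl | h0 := Nat.eq_zero_or_pos i
      · left; simp [Nat.sub_add_cancel hn, h]
      · exact Or.inr h0
    obtain hi' | h0 := hi'
    · rw [hi', ← mul_dvd_mul_iff_of_triangleFree hΓ (x := w), ← hy]
      exact hdvd _ (by omega)
    · obtain ⟨i, rfl⟩ : ∃ j, i = j + 1 := ⟨i - 1, by omega⟩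
      rw [← mul_dvd_mul_iff_of_triangleFree hΓ (x := w), ← hy]
      exact hdvd _ (by omega)
  obtain ⟨c, rfl⟩ := hly
  have hc : length c = 0 := by
    have := congrArg length hy
    simp only [length_mul] at this
    omega
  rw [eq_one_of_length_eq_zero hc, mul_one] at hy
  exact ⟨l, hy⟩

end ArtinMonoid

/-- The relators of the small-type Artin group of a simple graph. -/
def artinRelators {S : Type*} (Γ : SimpleGraph S) : Set (FreeGroup S) :=
  {x | ∃ u v, ArtinRel Γ u v ∧
    x = FreeMonoid.lift FreeGroup.of u * (FreeMonoid.lift FreeGroup.of v)⁻¹}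

/-- The small-type Artin group of a simple graph. -/
abbrev ArtinGroup {S : Type*} (Γ : SimpleGraph S) : Type _ := PresentedGroup (artinRelators Γ)

namespace ArtinGroup

open ArtinMonoid

variable {S : Type*} {Γ : SimpleGraph S} {H : Type*} [Group H]

/-- The homomorphism out of an Artin group determined by images of the generators. -/
def lift (f : S → H) (hb : ∀ s t, Γ.Adj s t → f s * f t * f s = f t * f s * f t)
    (hc : ∀ s t, ¬ Γ.Adj s t → f s * f t = f t * f s) : ArtinGroup Γ →* H :=
  PresentedGroup.toGroup (f := f) <| by
    rintro _ ⟨_, _, ⟨h⟩ | ⟨h⟩, rfl⟩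
    · rw [map_mul, map_inv, mul_inv_eq_one]
      simpa using hb _ _ h
    · rw [map_mul, map_inv, mul_inv_eq_one]
      simpa using hc _ _ h

/-- The standard generators of the Artin group. -/
abbrev gen (Γ : SimpleGraph S) (s : S) : ArtinGroup Γ := PresentedGroup.of s

@[simp] theorem lift_gen (f : S → H) (hb : ∀ s t, Γ.Adj s t → f s * f t * f s = f t * f s * f t)
    (hc : ∀ s t, ¬ Γ.Adj s t → f s * f t = f t * f s) (s : S) : lift f hb hc (gen Γ s) = f s :=
  PresentedGroup.toGroup.of _

theorem gen_braid {s t : S} (h : Γ.Adj s t) :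
    gen Γ s * gen Γ t * gen Γ s = gen Γ t * gen Γ s * gen Γ t :=
  PresentedGroup.mk_eq_mk_of_mul_inv_mem ⟨_, _, .braid h, rfl⟩

theorem gen_comm {s t : S} (h : ¬ Γ.Adj s t) : gen Γ s * gen Γ t = gen Γ t * gen Γ s :=
  PresentedGroup.mk_eq_mk_of_mul_inv_mem ⟨_, _, .comm h, rfl⟩

/-- The canonical map from the Artin monoid to the Artin group. -/
def ofMonoid (Γ : SimpleGraph S) : ArtinMonoid Γ →* ArtinGroup Γ :=
  PresentedMonoid.lift (gen Γ) <| by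
    rintro _ _ (h | h)
    · simpa using gen_braid h
    · simpa using gen_comm h

@[simp] theorem ofMonoid_of (s : S) :
    ofMonoid Γ (PresentedMonoid.of (ArtinRel Γ) s) = gen Γ s := rfl

/-- The powers of a central element form an Ore set. -/
abbrev oreSetPowers {M : Type*} [Monoid M] {z : M} (hz : ∀ x, z * x = x * z) :
    OreLocalization.OreSet (Submonoid.powers z) :=
  have hcomm : ∀ (s : Submonoid.powers z) (x : M), (s : M) * x = x * s := by
    rintro ⟨_, n, rfl⟩ x
    exact (Commute.pow_left (hz x) n)
  { ore_right_cancel := fun r₁ r₂ s h => ⟨s, by rw [hcomm, hcomm, h]⟩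
    oreNum := fun r _ => r
    oreDenom := fun _ s => s
    ore_eq := fun r s => hcomm s r }

theorem ofMonoid_injective (hΓ : ∀ s t r, Γ.Adj s t → Γ.Adj t r → ¬ Γ.Adj s r)
    {z : ArtinMonoid Γ} (hz : IsGarside z) : Function.Injective (ofMonoid Γ) := by
  let := oreSetPowers hz.comm
  let num : ArtinMonoid Γ →* OreLocalization (Submonoid.powers z) (ArtinMonoid Γ) :=
    OreLocalization.numeratorHom
  have hunit : ∀ s, IsUnit (num (ArtinMonoid.gen Γ s)) := fun s => by
    obtain ⟨y, hy⟩ := hz.gen_dvd s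
    have hc : Commute (ArtinMonoid.gen Γ s) y := by
      refine mul_left_cancel_of_triangleFree hΓ (x := ArtinMonoid.gen Γ s) ?_
      rw [← hy, ← mul_assoc, ← hy, hz.comm]
    have hzu : IsUnit (num z) :=
      OreLocalization.numerator_isUnit (⟨z, Submonoid.mem_powers z⟩ : Submonoid.powers z)
    have hmul : num z = num (ArtinMonoid.gen Γ s) * num y := by rw [← map_mul, ← hy]
    rw [hmul, (hc.map num).isUnit_mul_iff] at hzu
    exact hzu.1
  choose f hf using hunit
  let ψ : ArtinGroup Γ →* (OreLocalization (Submonoid.powers z) (ArtinMonoid Γ))ˣ :=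
    lift f
      (fun s t h => Units.ext <| by
        simp only [Units.val_mul, hf, ← map_mul, ArtinMonoid.gen_braid h])
      (fun s t h => Units.ext <| by
        simp only [Units.val_mul, hf, ← map_mul, ArtinMonoid.gen_comm h])
  have hψ : ((Units.coeHom _).comp ψ).comp (ofMonoid Γ) = num :=
    PresentedMonoid.ext _ fun s => by
      have : ψ (gen Γ s) = f s := lift_gen _ _ _ s
      rw [MonoidHom.comp_apply, ofMonoid_of, MonoidHom.comp_apply, this]
      exact hf s
  intro a b hab
  have hnum : num a = num b := by
    rw [← hψ]
    simp only [MonoidHom.comp_apply, hab]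
  obtain ⟨u, v, h1, h2⟩ := OreLocalization.oreDiv_eq_iff.1 hnum
  simp only [OneMemClass.coe_one, mul_one] at h2
  rw [← h2] at h1
  exact (mul_left_cancel_of_triangleFree hΓ h1).symm

theorem exists_pow_mul_eq {z : ArtinMonoid Γ} (hz : IsGarside z) (g : ArtinGroup Γ) :
    ∃ (n : ℕ) (q : ArtinMonoid Γ), ofMonoid Γ z ^ n * g = ofMonoid Γ q := by
  have hzs : ∀ s, Commute (ofMonoid Γ z) (gen Γ s) := fun s => by
    have := congrArg (ofMonoid Γ) (hz.comm (ArtinMonoid.gen Γ s))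
    rwa [map_mul, map_mul] at this
  have hg : g ∈ Subgroup.closure (Set.range (gen Γ)) := by
    rw [PresentedGroup.closure_range_of]; trivial
  induction hg using Subgroup.closure_induction_left with
  | one => exact ⟨0, 1, by simp⟩
  | mul_left x hx y hy ih =>
    obtain ⟨s, rfl⟩ := hx
    obtain ⟨n, q, hq⟩ := ih
    refine ⟨n, ArtinMonoid.gen Γ s * q, ?_⟩
    rw [← mul_assoc, ((hzs s).pow_left n).eq, mul_assoc, hq, map_mul, ofMonoid_of]
  | inv_mul_cancel x hx y hy ih =>
    obtain ⟨s, rfl⟩ := hx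
    obtain ⟨n, q, hq⟩ := ih
    obtain ⟨d, hd⟩ := hz.gen_dvd s
    refine ⟨n + 1, d * q, ?_⟩
    rw [← mul_assoc, ((hzs s).pow_left (n + 1)).inv_right.eq, mul_assoc, pow_succ', mul_assoc, hq,
      hd, map_mul, map_mul, ofMonoid_of]
    group

/-- A triangle-free small-type Artin group with a Garside element is torsion-free. -/
theorem isMulTorsionFree_of_isGarside (hΓ : ∀ s t r, Γ.Adj s t → Γ.Adj t r → ¬ Γ.Adj s r)
    {z : ArtinMonoid Γ} (hz : IsGarside z) {g : ArtinGroup Γ} {n : ℕ} (hn : 0 < n)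
    (hg : g ^ n = 1) : g = 1 := by
  obtain ⟨k, q, hq⟩ := exists_pow_mul_eq hz g
  have hw : ∀ x, z ^ k * x = x * z ^ k := fun x => (Commute.pow_left (hz.comm x) k)
  have hwg : Commute (ofMonoid Γ z ^ k) g := by
    have := congrArg (ofMonoid Γ) (hw q)
    rw [map_mul, map_mul, ← hq, map_pow] at this
    rw [mul_assoc] at this
    exact mul_left_cancel this
  have hpow : q ^ n = (z ^ k) ^ n := by
    apply ofMonoid_injective hΓ hz
    rw [map_pow, ← hq, hwg.mul_pow, hg, mul_one, map_pow, map_pow]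
  obtain ⟨x, hx⟩ := exists_mul_eq_of_pow_eq hΓ hz hw hn hpow
  have := congrArg (ofMonoid Γ) hx
  rw [map_mul, map_mul, ← hq, map_pow, mul_assoc] at this
  simpa using this

end ArtinGroup

/-- A finite sequence `σ 0, …, σ (n - 1)` satisfying the relations of the braid group on `n + 1`
strands. -/
structure IsBraidSeq {M : Type*} [Monoid M] (n : ℕ) (σ : ℕ → M) : Prop where
  braid : ∀ i, i + 1 < n → σ i * σ (i + 1) * σ i = σ (i + 1) * σ i * σ (i + 1)
  comm : ∀ i j, i + 2 ≤ j → j < n → σ i * σ j = σ j * σ i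

/-- The product `σ 0 * σ 1 * ⋯ * σ (k - 1)`. -/
def rangeProd {M : Type*} [Monoid M] (σ : ℕ → M) (k : ℕ) : M := ((List.range k).map σ).prod

section rangeProd

variable {M N : Type*} [Monoid M] [Monoid N]

@[simp] theorem rangeProd_zero (σ : ℕ → M) : rangeProd σ 0 = 1 := rfl

theorem rangeProd_succ (σ : ℕ → M) (k : ℕ) : rangeProd σ (k + 1) = rangeProd σ k * σ k :=
  List.prod_range_succ σ k

theorem rangeProd_succ' (σ : ℕ → M) (k : ℕ) :
    rangeProd σ (k + 1) = σ 0 * rangeProd (fun i => σ (i + 1)) k :=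
  List.prod_range_succ' σ k

theorem rangeProd_congr {σ τ : ℕ → M} {k : ℕ} (h : ∀ i < k, σ i = τ i) :
    rangeProd σ k = rangeProd τ k := by
  rw [rangeProd, rangeProd, List.map_congr_left fun i hi => h i (List.mem_range.1 hi)]

theorem map_rangeProd (f : M →* N) (σ : ℕ → M) (k : ℕ) :
    f (rangeProd σ k) = rangeProd (fun i => f (σ i)) k := by
  simp [rangeProd, map_list_prod, Function.comp_def]

theorem mul_rangeProd_comm {σ : ℕ → M} {x : M} {k : ℕ} (h : ∀ i < k, x * σ i = σ i * x) :
    x * rangeProd σ k = rangeProd σ k * x := by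
  induction k with
  | zero => simp
  | succ k ih =>
    rw [rangeProd_succ, ← mul_assoc, ih fun i hi => h i (by omega), mul_assoc, h k (by omega),
      mul_assoc]

theorem pow_mul_of_shift {σ : ℕ → M} {δ : M} {n : ℕ}
    (h : ∀ i, i + 1 < n → δ * σ i = σ (i + 1) * δ) (k i : ℕ) (hk : i + k < n) :
    δ ^ k * σ i = σ (i + k) * δ ^ k := by
  induction k with
  | zero => simp
  | succ k ih =>
    rw [pow_succ', mul_assoc, ih (by omega), ← mul_assoc, h _ (by omega), mul_assoc, add_assoc]

theorem pow_mul_comm_of_shift {σ : ℕ → M} {δ : M} {n : ℕ}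
    (h : ∀ i, i + 1 < n → δ * σ i = σ (i + 1) * δ) (h' : δ ^ 2 * σ (n - 1) = σ 0 * δ ^ 2)
    (i : ℕ) (hi : i < n) : δ ^ (n + 1) * σ i = σ i * δ ^ (n + 1) := by
  obtain ⟨k, rfl⟩ : ∃ k, n = i + 1 + k := ⟨n - (i + 1), by omega⟩
  have h1 := pow_mul_of_shift h k i (by omega)
  have h2 := pow_mul_of_shift h i 0 (by omega)
  rw [show i + 1 + k - 1 = i + k by omega] at h'
  rw [zero_add] at h2
  calc δ ^ (i + 1 + k + 1) * σ i = δ ^ i * (δ ^ 2 * (δ ^ k * σ i)) := by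
        simp only [← mul_assoc, ← pow_add]; congr 2; omega
    _ = σ i * (δ ^ i * (δ ^ 2 * δ ^ k)) := by
        rw [h1, ← mul_assoc (δ ^ 2), h', ← mul_assoc, ← mul_assoc, h2]; simp only [mul_assoc]
    _ = _ := by simp only [← pow_add]; congr 2; omega

namespace IsBraidSeq

variable {n : ℕ} {σ : ℕ → M}

theorem map (hσ : IsBraidSeq n σ) (f : M →* N) : IsBraidSeq n fun i => f (σ i) where
  braid i hi := by simpa using congrArg f (hσ.braid i hi)
  comm i j hij hj := by simpa using congrArg f (hσ.comm i j hij hj)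

theorem rangeProd_mul (hσ : IsBraidSeq n σ) {i k : ℕ} (hik : i + 1 < k) (hk : k ≤ n) :
    rangeProd σ k * σ i = σ (i + 1) * rangeProd σ k := by
  induction k with
  | zero => omega
  | succ k ih =>
    obtain rfl | hlt : k = i + 1 ∨ i + 1 < k := by omega
    · have hc := mul_rangeProd_comm (σ := σ) (x := σ (i + 1)) (k := i)
        fun j hj => (hσ.comm j (i + 1) (by omega) (by omega)).symm
      have hb := hσ.braid i (by omega)
      rw [rangeProd_succ, rangeProd_succ]
      simp only [mul_assoc] at hb ⊢
      rw [hb, ← mul_assoc, ← hc, mul_assoc]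
    · rw [rangeProd_succ, mul_assoc, ← hσ.comm i k (by omega) (by omega), ← mul_assoc,
        ih hlt (by omega), mul_assoc]

theorem rangeProd_sq_mul (hσ : IsBraidSeq n σ) (hn : 0 < n) :
    rangeProd σ n ^ 2 * σ (n - 1) = σ 0 * rangeProd σ n ^ 2 := by
  obtain ⟨n, rfl⟩ : ∃ m, n = m + 1 := ⟨n - 1, by omega⟩
  have key : ∀ k ≤ n, rangeProd σ (n + 1) * rangeProd σ k =
      rangeProd (fun i => σ (i + 1)) k * rangeProd σ (n + 1) := by
    intro k hk
    induction k with
    | zero => simp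
    | succ k ih =>
      rw [rangeProd_succ σ k, rangeProd_succ _ k, ← mul_assoc, ih (by omega), mul_assoc,
        hσ.rangeProd_mul (by omega) le_rfl, mul_assoc]
  have h := key n le_rfl
  rw [Nat.add_sub_cancel, pow_two]
  conv_rhs => rw [← mul_assoc, rangeProd_succ σ n, ← mul_assoc, mul_assoc (σ 0),
    ← rangeProd_succ, h, ← mul_assoc, ← rangeProd_succ']

end IsBraidSeq

end rangeProd

theorem pathGraph_triangleFree (n : ℕ) (s t r : Fin n) (h : (SimpleGraph.pathGraph n).Adj s t)
    (h' : (SimpleGraph.pathGraph n).Adj t r) : ¬ (SimpleGraph.pathGraph n).Adj s r := by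
  rw [SimpleGraph.pathGraph_adj] at *
  omega

/-- Extend a family indexed by `Fin n` by `1`. -/
def natExtend {M : Type*} [One M] {n : ℕ} (f : Fin n → M) (i : ℕ) : M :=
  if h : i < n then f ⟨i, h⟩ else 1

theorem natExtend_of_lt {M : Type*} [One M] {n : ℕ} (f : Fin n → M) {i : ℕ} (h : i < n) :
    natExtend f i = f ⟨i, h⟩ := dif_pos h

theorem isBraidSeq_natExtend {M : Type*} [Monoid M] {n : ℕ} {f : Fin n → M}
    (hb : ∀ i j, (SimpleGraph.pathGraph n).Adj i j → f i * f j * f i = f j * f i * f j)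
    (hc : ∀ i j, ¬ (SimpleGraph.pathGraph n).Adj i j → f i * f j = f j * f i) :
    IsBraidSeq n (natExtend f) where
  braid i hi := by
    rw [natExtend_of_lt f hi, natExtend_of_lt f (by omega : i < n)]
    exact hb _ _ (by simp [SimpleGraph.pathGraph_adj])
  comm i j hij hj := by
    rw [natExtend_of_lt f hj, natExtend_of_lt f (by omega : i < n)]
    exact hc _ _ (by simp only [SimpleGraph.pathGraph_adj]; omega)

theorem IsBraidSeq.pathGraph_braid {M : Type*} [Monoid M] {n : ℕ} {σ : ℕ → M}
    (hσ : IsBraidSeq n σ) (i j : Fin n) (h : (SimpleGraph.pathGraph n).Adj i j) :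
    σ i * σ j * σ i = σ j * σ i * σ j := by
  rw [SimpleGraph.pathGraph_adj] at h
  obtain h | h := h
  · have := hσ.braid i (by omega)
    rwa [h] at this
  · have := hσ.braid j (by omega)
    rw [h] at this
    exact this.symm

theorem IsBraidSeq.pathGraph_comm {M : Type*} [Monoid M] {n : ℕ} {σ : ℕ → M}
    (hσ : IsBraidSeq n σ) (i j : Fin n) (h : ¬ (SimpleGraph.pathGraph n).Adj i j) :
    σ i * σ j = σ j * σ i := by
  rw [SimpleGraph.pathGraph_adj] at h
  obtain h | h | h : (i : ℕ) = j ∨ (i : ℕ) + 2 ≤ j ∨ (j : ℕ) + 2 ≤ i := by omega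
  · rw [h]
  · exact hσ.comm _ _ h j.2
  · exact (hσ.comm _ _ h i.2).symm

/-- The `(n + 1)`-st power of the product of the generators is a Garside element of the braid
monoid on `n + 1` strands. -/
theorem isGarside_rangeProd_pow (n : ℕ) :
    ArtinMonoid.IsGarside
      (rangeProd (natExtend (ArtinMonoid.gen (SimpleGraph.pathGraph n))) n ^ (n + 1)) := by
  set σ := natExtend (ArtinMonoid.gen (SimpleGraph.pathGraph n))
  have hσ : IsBraidSeq n σ :=
    isBraidSeq_natExtend (fun _ _ => ArtinMonoid.gen_braid) (fun _ _ => ArtinMonoid.gen_comm)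
  have hgen : ∀ s : Fin n, ArtinMonoid.gen _ s = σ s := fun s => (natExtend_of_lt _ s.2).symm
  have hshift : ∀ i, i + 1 < n → rangeProd σ n * σ i = σ (i + 1) * rangeProd σ n :=
    fun i hi => hσ.rangeProd_mul hi le_rfl
  constructor
  · intro x
    obtain ⟨u, rfl⟩ := PresentedMonoid.surjective_mk x
    induction u using FreeMonoid.inductionOn' with
    | one => simp
    | of_mul s u ih =>
      have hs := pow_mul_comm_of_shift hshift (hσ.rangeProd_sq_mul (by have := s.2; omega)) s s.2
      rw [← hgen] at hs
      rw [map_mul, mul_assoc, ← ih, ← mul_assoc, ← mul_assoc]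
      exact congrArg (· * _) hs
  · intro s
    obtain ⟨m, rfl⟩ : ∃ m, n = m + 1 := ⟨n - 1, by have := s.2; omega⟩
    have h0 := pow_mul_of_shift hshift s 0 (by omega)
    rw [zero_add] at h0
    obtain ⟨k, hk⟩ : ∃ k, m + 1 = s + k := ⟨m + 1 - s, by omega⟩
    refine ⟨rangeProd σ (m + 1) ^ (s : ℕ) *
      (rangeProd (fun i => σ (i + 1)) m * rangeProd σ (m + 1) ^ k), ?_⟩
    rw [hgen, ← mul_assoc, ← h0, mul_assoc, ← mul_assoc (σ 0), ← rangeProd_succ', ← pow_succ',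
      ← pow_add]
    congr 1
    omega

/-- The braid group on `n + 1` strands is torsion-free. -/
theorem braidGroup_eq_one_of_pow_eq_one {n : ℕ} {g : ArtinGroup (SimpleGraph.pathGraph n)} {k : ℕ}
    (hk : 0 < k) (hg : g ^ k = 1) : g = 1 :=
  ArtinGroup.isMulTorsionFree_of_isGarside (pathGraph_triangleFree n) (isGarside_rangeProd_pow n)
    hk hg

open FreeGroup in
/-- The Artin automorphism `x i ↦ x (i + 1)`, `x (i + 1) ↦ (x (i + 1))⁻¹ * x i * x (i + 1)`. -/
def artinAut (i : ℕ) : MulAut (FreeGroup ℕ) :=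
  MonoidHom.toMulEquiv
    (FreeGroup.lift fun j =>
      if j = i then of (i + 1) else if j = i + 1 then (of (i + 1))⁻¹ * of i * of (i + 1) else of j)
    (FreeGroup.lift fun j =>
      if j = i then of i * of (i + 1) * (of i)⁻¹ else if j = i + 1 then of i else of j)
    (by
      ext j
      by_cases h : j = i
      · simp [h]
      by_cases h' : j = i + 1
      · simp [h', mul_assoc]
      · simp [h, h'])
    (by
      ext j
      by_cases h : j = i
      · simp [h, mul_assoc]
      by_cases h' : j = i + 1
      · simp [h']
      · simp [h, h'])

theorem artinAut_of (i j : ℕ) : artinAut i (FreeGroup.of j) =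
    if j = i then FreeGroup.of (i + 1) else if j = i + 1 then
      (FreeGroup.of (i + 1))⁻¹ * FreeGroup.of i * FreeGroup.of (i + 1) else FreeGroup.of j := by
  simp [artinAut]

theorem artinAut_of_self (i : ℕ) : artinAut i (.of i) = .of (i + 1) := by simp [artinAut_of]

theorem artinAut_of_succ (i : ℕ) :
    artinAut i (.of (i + 1)) = (.of (i + 1))⁻¹ * .of i * .of (i + 1) := by simp [artinAut_of]

theorem artinAut_of_ne {i j : ℕ} (h : j ≠ i) (h' : j ≠ i + 1) : artinAut i (.of j) = .of j := by
  simp [artinAut_of, h, h']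

theorem freeGroup_mulAut_ext {α : Type*} {f g : MulAut (FreeGroup α)}
    (h : ∀ a, f (.of a) = g (.of a)) : f = g :=
  MulEquiv.toMonoidHom_injective (FreeGroup.ext_hom _ _ h)

theorem isBraidSeq_artinAut (n : ℕ) : IsBraidSeq n artinAut where
  braid i _ := by
    refine freeGroup_mulAut_ext fun j => ?_
    simp only [MulAut.mul_apply]
    have h₁ : artinAut i (.of (i + 2)) = .of (i + 2) := artinAut_of_ne (by omega) (by omega)
    have h₂ : artinAut (i + 1) (.of i) = .of i := artinAut_of_ne (by omega) (by omega)
    have h₃ : artinAut (i + 1) (.of (i + 1)) = .of (i + 2) := artinAut_of_self _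
    have h₄ : artinAut (i + 1) (.of (i + 2)) = (.of (i + 2))⁻¹ * .of (i + 1) * .of (i + 2) :=
      artinAut_of_succ _
    by_cases h : j = i ∨ j = i + 1 ∨ j = i + 2
    · obtain h | h | h := h <;>
      · simp only [h, mul_assoc, mul_inv_rev, inv_inv, mul_inv_cancel_left, artinAut_of_self i,
          artinAut_of_succ i, h₁, h₂, h₃, h₄, map_mul, map_inv]
    · simp only [artinAut_of_ne (show j ≠ i by omega) (show j ≠ i + 1 by omega),
        artinAut_of_ne (show j ≠ i + 1 by omega) (show j ≠ i + 1 + 1 by omega)]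
  comm i j hij _ := by
    refine freeGroup_mulAut_ext fun k => ?_
    simp only [MulAut.mul_apply]
    by_cases h0 : k = i ∨ k = i + 1
    · have hk : artinAut j (.of k) = .of k := artinAut_of_ne (by omega) (by omega)
      have hi : artinAut j (.of i) = .of i := artinAut_of_ne (by omega) (by omega)
      have hi' : artinAut j (.of (i + 1)) = .of (i + 1) := artinAut_of_ne (by omega) (by omega)
      rw [hk]
      obtain rfl | rfl := h0
      · rw [artinAut_of_self, hi']
      · simp only [artinAut_of_succ, map_mul, map_inv, hi, hi']
    · have hk : artinAut i (.of k) = .of k := artinAut_of_ne (by omega) (by omega)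
      have hj : artinAut i (.of j) = .of j := artinAut_of_ne (by omega) (by omega)
      have hj' : artinAut i (.of (j + 1)) = .of (j + 1) := artinAut_of_ne (by omega) (by omega)
      rw [hk, artinAut_of]
      split_ifs
      · rw [hj']
      · simp only [map_mul, map_inv, hj, hj']
      · rw [hk]

/-- The Artin representation of the braid group on `n + 1` strands. -/
def artinRep (n : ℕ) : ArtinGroup (SimpleGraph.pathGraph n) →* MulAut (FreeGroup ℕ) :=
  ArtinGroup.lift (fun i => artinAut i) (isBraidSeq_artinAut n).pathGraph_braid
    (isBraidSeq_artinAut n).pathGraph_comm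

/-- The semidirect product of a free group with the braid group via the Artin representation; it
contains the annular braid group as a retract. -/
abbrev ArtinSemidirect (n : ℕ) : Type := FreeGroup ℕ ⋊[artinRep n]
  ArtinGroup (SimpleGraph.pathGraph n)

namespace ArtinSemidirect

variable {n : ℕ}

theorem eq_one_of_pow_eq_one {g : ArtinSemidirect n} {k : ℕ} (hk : 0 < k) (hg : g ^ k = 1) :
    g = 1 := by
  have hr : g.right = 1 := by
    have := congrArg SemidirectProduct.rightHom hg
    rw [map_pow, map_one] at this
    exact braidGroup_eq_one_of_pow_eq_one hk this
  rw [← SemidirectProduct.inl_left_mul_inr_right g, hr, map_one, mul_one] at hg ⊢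
  rw [← map_pow, ← map_one SemidirectProduct.inl, SemidirectProduct.inl_inj] at hg
  rw [(pow_eq_one_iff_left hk.ne').1 hg, map_one]

/-- The braid generators. -/
def sigma (n i : ℕ) : ArtinSemidirect n :=
  SemidirectProduct.inr (natExtend (ArtinGroup.gen (SimpleGraph.pathGraph n)) i)

/-- The free generators. -/
def x (n i : ℕ) : ArtinSemidirect n := SemidirectProduct.inl (.of i)

theorem isBraidSeq_sigma (n : ℕ) : IsBraidSeq n (sigma n) :=
  (isBraidSeq_natExtend (fun _ _ => ArtinGroup.gen_braid) fun _ _ => ArtinGroup.gen_comm).map _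

theorem sigma_mul_inl {i : ℕ} (hi : i < n) (w : FreeGroup ℕ) :
    sigma n i * SemidirectProduct.inl w = SemidirectProduct.inl (artinAut i w) * sigma n i := by
  have h : artinRep n (natExtend (ArtinGroup.gen (SimpleGraph.pathGraph n)) i) = artinAut i := by
    rw [natExtend_of_lt _ hi, artinRep, ArtinGroup.lift_gen]
  rw [← h, SemidirectProduct.inl_aut, sigma, map_inv]
  group

theorem sigma_mul_x_self {i : ℕ} (hi : i < n) : sigma n i * x n i = x n (i + 1) * sigma n i := by
  rw [x, sigma_mul_inl hi, artinAut_of_self, x]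

theorem sigma_mul_x_mul_x {i : ℕ} (hi : i < n) :
    sigma n i * (x n i * x n (i + 1)) = x n i * x n (i + 1) * sigma n i := by
  rw [x, x, ← map_mul, sigma_mul_inl hi, map_mul, artinAut_of_self, artinAut_of_succ]
  congr 2
  group

theorem sigma_mul_x_of_ne {i j : ℕ} (hi : i < n) (h : j ≠ i) (h' : j ≠ i + 1) :
    sigma n i * x n j = x n j * sigma n i := by
  rw [x, sigma_mul_inl hi, artinAut_of_ne h h']

/-- The element rotating the annulus. -/
def rot (n : ℕ) : ArtinSemidirect n := x n 0 * rangeProd (sigma n) n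

theorem rot_mul_sigma {i : ℕ} (hi : i + 1 < n) :
    rot n * sigma n i = sigma n (i + 1) * rot n := by
  rw [rot, mul_assoc, (isBraidSeq_sigma n).rangeProd_mul hi le_rfl, ← mul_assoc,
    ← sigma_mul_x_of_ne hi (by omega) (by omega), mul_assoc]

theorem rangeProd_mul_x_zero (hn : 0 < n) :
    rangeProd (sigma n) n * x n 0 = x n 1 * rangeProd (sigma n) n := by
  obtain ⟨m, rfl⟩ : ∃ m, n = m + 1 := ⟨n - 1, by omega⟩
  rw [rangeProd_succ', mul_assoc, ← mul_rangeProd_comm, ← mul_assoc, sigma_mul_x_self hn,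
    mul_assoc]
  exact fun i hi => (sigma_mul_x_of_ne (by omega) (by omega) (by omega)).symm

theorem rot_sq_mul_sigma (hn : 0 < n) : rot n ^ 2 * sigma n (n - 1) = sigma n 0 * rot n ^ 2 := by
  have h : rot n ^ 2 = x n 0 * x n 1 * rangeProd (sigma n) n ^ 2 := by
    rw [rot, pow_two, pow_two, mul_assoc, ← mul_assoc (rangeProd _ _), rangeProd_mul_x_zero hn]
    simp only [mul_assoc]
  rw [h, mul_assoc, (isBraidSeq_sigma n).rangeProd_sq_mul hn, ← mul_assoc, ← mul_assoc,
    sigma_mul_x_mul_x hn]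

end ArtinSemidirect

/-- The euclidean Artin group of type `Ã_n`. -/
abbrev ArtinAtilde (n : ℕ) : Type := PresentedGroup (relsArtinAtilde n)

namespace ArtinAtilde

variable {n : ℕ} {H : Type*} [Group H]

/-- The standard generators. -/
abbrev gen (n : ℕ) (i : ZMod (n + 1)) : ArtinAtilde n := PresentedGroup.of i

theorem gen_braid (i : ZMod (n + 1)) :
    gen n i * gen n (i + 1) * gen n i = gen n (i + 1) * gen n i * gen n (i + 1) :=
  PresentedGroup.mk_eq_mk_of_mul_inv_mem (Or.inl ⟨i, rfl⟩)

theorem gen_comm {i j : ZMod (n + 1)} (h : j ≠ i + 1) (h' : j ≠ i - 1) :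
    gen n i * gen n j = gen n j * gen n i :=
  PresentedGroup.mk_eq_mk_of_mul_inv_mem (Or.inr ⟨i, j, h, h', rfl⟩)

/-- The homomorphism determined by images of the generators. -/
def lift (f : ZMod (n + 1) → H) (hb : ∀ i, f i * f (i + 1) * f i = f (i + 1) * f i * f (i + 1))
    (hc : ∀ i j, j ≠ i + 1 → j ≠ i - 1 → f i * f j = f j * f i) : ArtinAtilde n →* H :=
  PresentedGroup.toGroup (f := f) <| by
    rintro _ (⟨i, rfl⟩ | ⟨i, j, h, h', rfl⟩)
    · rw [map_mul, map_inv, mul_inv_eq_one]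
      simpa using hb i
    · rw [map_mul, map_inv, mul_inv_eq_one]
      simpa using hc i j h h'

@[simp] theorem lift_gen (f : ZMod (n + 1) → H)
    (hb : ∀ i, f i * f (i + 1) * f i = f (i + 1) * f i * f (i + 1))
    (hc : ∀ i j, j ≠ i + 1 → j ≠ i - 1 → f i * f j = f j * f i) (i : ZMod (n + 1)) :
    lift f hb hc (gen n i) = f i :=
  PresentedGroup.toGroup.of _

/-- Shift of the indices of the generators. -/
def shiftHom (n : ℕ) (c : ZMod (n + 1)) : ArtinAtilde n →* ArtinAtilde n :=
  lift (fun i => gen n (i + c))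
    (fun i => by rw [add_right_comm]; exact gen_braid _)
    (fun i j h h' => gen_comm (fun e => h (add_right_cancel (b := c) (by rw [e]; ring)))
      (fun e => h' (add_right_cancel (b := c) (by rw [e]; ring))))

/-- The rotation automorphism `t_i ↦ t_{i + 1}`. -/
def rotation (n : ℕ) : MulAut (ArtinAtilde n) :=
  MonoidHom.toMulEquiv (shiftHom n 1) (shiftHom n (-1))
    (PresentedGroup.ext fun i => by
      change shiftHom n (-1) (shiftHom n 1 (gen n i)) = gen n i
      simp [shiftHom])
    (PresentedGroup.ext fun i => by
      change shiftHom n 1 (shiftHom n (-1) (gen n i)) = gen n i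
      simp [shiftHom])

theorem rotation_gen (i : ZMod (n + 1)) : rotation n (gen n i) = gen n (i + 1) := by
  change shiftHom n 1 (gen n i) = _
  exact lift_gen _ _ _ i

/-- The homomorphism determined by a braid sequence cyclically permuted by conjugation. -/
theorem exists_hom_of_shift (hn : 2 ≤ n) {σ : ℕ → H} {T : H} (hσ : IsBraidSeq n σ)
    (hT : ∀ i, i + 1 < n → T * σ i = σ (i + 1) * T) (hT' : T ^ 2 * σ (n - 1) = σ 0 * T ^ 2) :
    ∃ f : ArtinAtilde n →* H, ∀ i : ZMod (n + 1),
      f (gen n i) = T ^ i.val * σ 0 * (T ^ i.val)⁻¹ := by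
  let c : ℕ → H := fun k => T ^ k * σ 0 * (T ^ k)⁻¹
  have hc : ∀ k < n, c k = σ k := fun k hk => by
    have := pow_mul_of_shift hT k 0 (by omega)
    simp only [c, this, zero_add, mul_inv_cancel_right]
  have hadd : ∀ k l, c (k + l) = T ^ k * c l * (T ^ k)⁻¹ := fun k l => by
    simp only [c, pow_add]; group
  have hper : ∀ k, c (k + (n + 1)) = c k := fun k => by
    rw [hadd]
    have : c (n + 1) = σ 0 := by
      simp only [c, pow_mul_comm_of_shift hT hT' 0 (by omega), mul_inv_cancel_right]
    rw [this]
  have hmod : ∀ k, c (k % (n + 1)) = c k := fun k => by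
    exact (Function.Periodic.map_mod_nat hper k)
  have hval : ∀ i d : ZMod (n + 1), c (i + d).val = T ^ i.val * c d.val * (T ^ i.val)⁻¹ :=
    fun i d => by rw [ZMod.val_add, hmod, hadd]
  have hval0 : ∀ i : ZMod (n + 1), c i.val = T ^ i.val * σ 0 * (T ^ i.val)⁻¹ := fun _ => rfl
  have hone : (1 : ZMod (n + 1)).val = 1 := ZMod.val_one'' (by omega)
  refine ⟨lift (fun i => c i.val) (fun i => ?_) (fun i j h h' => ?_), fun i => lift_gen _ _ _ i⟩
  · rw [hval, hval0, hone, hc 1 (by omega)]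
    have := hσ.braid 0 (by omega)
    rw [zero_add] at this
    have := congrArg (fun y => T ^ i.val * y * (T ^ i.val)⁻¹) this
    simpa only [mul_assoc, inv_mul_cancel_left] using this
  · obtain ⟨d, rfl⟩ : ∃ d, j = i + d := ⟨j - i, by ring⟩
    have hcomm : σ 0 * c d.val = c d.val * σ 0 := by
      have h1 : d.val ≠ 1 := fun e => h (by
        rw [← ZMod.natCast_zmod_val d, e, Nat.cast_one])
      have h2 : d.val ≠ n := fun e => h' (by
        have : ((n + 1 : ℕ) : ZMod (n + 1)) = 0 := ZMod.natCast_self _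
        rw [← ZMod.natCast_zmod_val d, e]
        push_cast at this
        linear_combination this)
      have h3 := ZMod.val_lt d
      rw [hc _ (by omega)]
      obtain h0 | h0 := Nat.eq_zero_or_pos d.val
      · rw [h0]
      · exact hσ.comm 0 _ (by omega) (by omega)
    rw [hval, hval0]
    have := congrArg (fun y => T ^ i.val * y * (T ^ i.val)⁻¹) hcomm
    simpa only [mul_assoc, inv_mul_cancel_left] using this

end ArtinAtilde

namespace ArtinAtilde

/-- The holomorph of the euclidean Artin group. -/
abbrev Holomorph (n : ℕ) : Type :=
  ArtinAtilde n ⋊[MonoidHom.id (MulAut (ArtinAtilde n))] MulAut (ArtinAtilde n)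

namespace Holomorph

variable {n : ℕ}

/-- The generators `t_i`, indexed periodically by natural numbers. -/
def t (n i : ℕ) : Holomorph n := SemidirectProduct.inl (gen n (i : ZMod (n + 1)))

/-- The rotation as an element of the holomorph. -/
def tau (n : ℕ) : Holomorph n := SemidirectProduct.inr (rotation n)

theorem isBraidSeq_t (n : ℕ) : IsBraidSeq n (t n) where
  braid i _ := by
    have := congrArg (SemidirectProduct.inl : ArtinAtilde n →* Holomorph n)
      (gen_braid (n := n) (i : ZMod (n + 1)))
    simpa only [t, map_mul, Nat.cast_add, Nat.cast_one] using this
  comm i j hij hj := by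
    have key : ∀ {a b : ℕ}, a < n + 1 → b < n + 1 → (a : ZMod (n + 1)) = b → a = b :=
      fun ha hb h => by
        have := congrArg ZMod.val h
        rwa [ZMod.val_cast_of_lt ha, ZMod.val_cast_of_lt hb] at this
    simp only [t, ← map_mul]
    rw [gen_comm]
    · intro h
      have := key (a := j) (b := i + 1) (by omega) (by omega) (by push_cast; exact h)
      omega
    · intro h
      have := key (a := j + 1) (b := i) (by omega) (by omega)
        (by push_cast; rw [h]; ring)
      omega

theorem tau_mul_t (i : ℕ) : tau n * t n i = t n (i + 1) * tau n := by
  have := SemidirectProduct.inl_aut (φ := MonoidHom.id (MulAut (ArtinAtilde n))) (rotation n)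
    (gen n (i : ZMod (n + 1)))
  rw [MonoidHom.id_apply, rotation_gen] at this
  rw [t, t, Nat.cast_add, Nat.cast_one, this, tau, map_inv]
  group

theorem tau_sq_mul_t (hn : 0 < n) : tau n ^ 2 * t n (n - 1) = t n 0 * tau n ^ 2 := by
  have h : t n (n + 1) = t n 0 := by
    have : ((n + 1 : ℕ) : ZMod (n + 1)) = 0 := ZMod.natCast_self _
    rw [t, t, this, Nat.cast_zero]
  obtain ⟨m, rfl⟩ : ∃ m, n = m + 1 := ⟨n - 1, by omega⟩
  rw [pow_two, mul_assoc, Nat.add_sub_cancel, tau_mul_t, ← mul_assoc, tau_mul_t, h, mul_assoc]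

theorem tau_pow_mul_t (k : ℕ) : tau n ^ k * t n 0 * (tau n ^ k)⁻¹ = t n k := by
  have : ∀ k, tau n ^ k * t n 0 = t n k * tau n ^ k := fun k => by
    induction k with
    | zero => simp
    | succ k ih => rw [pow_succ', mul_assoc, ih, ← mul_assoc, tau_mul_t, mul_assoc]
  rw [this, mul_inv_cancel_right]

end Holomorph

end ArtinAtilde

/-- The images of the free generators determined by a braid sequence and a rotating element. -/
def freeSeq {H : Type*} [Group H] (n : ℕ) (s : ℕ → H) (τ : H) : ℕ → H
  | 0 => τ * (rangeProd s n)⁻¹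
  | j + 1 => if j < n then s j * freeSeq n s τ j * (s j)⁻¹ else 1

section FreeSeq

variable {H : Type*} [Group H] {n : ℕ} {s : ℕ → H} {τ : H}

theorem freeSeq_zero : freeSeq n s τ 0 = τ * (rangeProd s n)⁻¹ := rfl

theorem freeSeq_succ {j : ℕ} (hj : j < n) :
    freeSeq n s τ (j + 1) = s j * freeSeq n s τ j * (s j)⁻¹ := by
  rw [freeSeq, if_pos hj]

theorem freeSeq_of_lt {j : ℕ} (hj : n < j) : freeSeq n s τ j = 1 := by
  obtain ⟨m, rfl⟩ : ∃ m, j = m + 1 := ⟨j - 1, by omega⟩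
  rw [freeSeq, if_neg (by omega)]

theorem commute_freeSeq_of_lt (hs : IsBraidSeq n s)
    (hτ : ∀ i, i + 1 < n → τ * s i = s (i + 1) * τ) {i j : ℕ} (hi : i < n) (hj : j < i) :
    Commute (s i) (freeSeq n s τ j) := by
  induction j with
  | zero =>
    obtain ⟨k, rfl⟩ : ∃ k, i = k + 1 := ⟨i - 1, by omega⟩
    have h := hs.rangeProd_mul hi le_rfl
    have h' : s k * (rangeProd s n)⁻¹ = (rangeProd s n)⁻¹ * s (k + 1) := by
      rw [eq_inv_mul_iff_mul_eq, ← mul_assoc, h, mul_inv_cancel_right]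
    rw [freeSeq_zero, Commute, SemiconjBy, ← mul_assoc, ← hτ k hi, mul_assoc, h', mul_assoc]
  | succ j ih =>
    rw [freeSeq_succ (by omega)]
    have h : Commute (s i) (s j) := (hs.comm j i (by omega) hi).symm
    exact (h.mul_right (ih (by omega))).mul_right h.inv_right

theorem commute_freeSeq_of_add_two_le (hs : IsBraidSeq n s)
    (hτ : ∀ i, i + 1 < n → τ * s i = s (i + 1) * τ) {i j : ℕ} (hi : i < n) (hj : i + 2 ≤ j) :
    Commute (s i) (freeSeq n s τ j) := by
  obtain hjn | hjn := lt_or_ge n j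
  · rw [freeSeq_of_lt hjn]
    exact Commute.one_right _
  induction j, hj using Nat.le_induction with
  | base =>
    rw [freeSeq_succ (by omega), freeSeq_succ (by omega)]
    have hc := commute_freeSeq_of_lt hs hτ (i := i + 1) (j := i) (by omega) (by omega)
    have hb : MulAut.conj (s (i + 1) * s i) (s (i + 1)) = s i := by
      rw [MulAut.conj_apply, ← hs.braid i (by omega), mul_assoc (s i), mul_inv_cancel_right]
    have h := hc.map (MulAut.conj (s (i + 1) * s i))
    rw [hb] at h
    simpa only [MulAut.conj_apply, mul_assoc, mul_inv_rev] using h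
  | succ j hj ih =>
    rw [freeSeq_succ (by omega)]
    have h : Commute (s i) (s j) := hs.comm i j (by omega) (by omega)
    exact (h.mul_right (ih (by omega))).mul_right h.inv_right

theorem commute_freeSeq_of_ne (hs : IsBraidSeq n s)
    (hτ : ∀ i, i + 1 < n → τ * s i = s (i + 1) * τ) {i j : ℕ} (hi : i < n) (h : j ≠ i)
    (h' : j ≠ i + 1) : Commute (s i) (freeSeq n s τ j) := by
  obtain hj | hj := Nat.lt_or_gt_of_ne h
  · exact commute_freeSeq_of_lt hs hτ hi hj
  · exact commute_freeSeq_of_add_two_le hs hτ hi (by omega)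

theorem freeSeq_zero_mul_one (hs : IsBraidSeq n s)
    (hτ : ∀ i, i + 1 < n → τ * s i = s (i + 1) * τ) (hn : 0 < n) :
    freeSeq n s τ 0 * freeSeq n s τ 1 = τ ^ 2 * (rangeProd s n ^ 2)⁻¹ := by
  have h : rangeProd s n * freeSeq n s τ 0 = freeSeq n s τ 1 * rangeProd s n := by
    obtain ⟨m, rfl⟩ : ∃ m, n = m + 1 := ⟨n - 1, by omega⟩
    rw [rangeProd_succ', mul_assoc, ← mul_rangeProd_comm, freeSeq_succ hn]
    · group
    · exact fun i hi => (commute_freeSeq_of_lt hs hτ (by omega) (by omega)).symm.eq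
  rw [← mul_inv_eq_iff_eq_mul] at h
  rw [← h, freeSeq_zero, pow_two]
  group

theorem commute_freeSeq_mul (hs : IsBraidSeq n s)
    (hτ : ∀ i, i + 1 < n → τ * s i = s (i + 1) * τ) (hτ' : τ ^ 2 * s (n - 1) = s 0 * τ ^ 2)
    {i : ℕ} (hi : i < n) : Commute (s i) (freeSeq n s τ i * freeSeq n s τ (i + 1)) := by
  induction i with
  | zero =>
    rw [zero_add, freeSeq_zero_mul_one hs hτ hi]
    have h₁ : SemiconjBy (τ ^ 2) (s (n - 1)) (s 0) := hτ'
    have h₂ : SemiconjBy (rangeProd s n ^ 2) (s (n - 1)) (s 0) := hs.rangeProd_sq_mul hi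
    exact Commute.symm (h₁.mul_left h₂.inv_symm_left)
  | succ i ih =>
    have h := (ih (by omega)).map (MulAut.conj (s i * s (i + 1)))
    have h₁ : MulAut.conj (s i * s (i + 1)) (s i) = s (i + 1) := by
      rw [MulAut.conj_apply, hs.braid i hi, mul_assoc (s (i + 1)), mul_inv_cancel_right]
    have h₂ : MulAut.conj (s i * s (i + 1)) (freeSeq n s τ i) = freeSeq n s τ (i + 1) := by
      rw [map_mul, MulAut.mul_apply, MulAut.conj_apply (s (i + 1)),
        (commute_freeSeq_of_lt hs hτ hi (by omega)).eq, mul_inv_cancel_right, MulAut.conj_apply,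
        freeSeq_succ (by omega)]
    have h₃ : MulAut.conj (s i * s (i + 1)) (freeSeq n s τ (i + 1)) = freeSeq n s τ (i + 2) := by
      rw [map_mul, MulAut.mul_apply, MulAut.conj_apply (s (i + 1)), ← freeSeq_succ hi,
        MulAut.conj_apply,
        (commute_freeSeq_of_add_two_le hs hτ (by omega) (by omega)).eq, mul_inv_cancel_right]
    rwa [map_mul (MulAut.conj _) (freeSeq _ _ _ _), h₁, h₂, h₃] at h

/-- Conjugation by a braid sequence acts on `freeSeq` through the Artin automorphisms. -/
theorem lift_freeSeq_artinAut (hs : IsBraidSeq n s)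
    (hτ : ∀ i, i + 1 < n → τ * s i = s (i + 1) * τ) (hτ' : τ ^ 2 * s (n - 1) = s 0 * τ ^ 2)
    {i : ℕ} (hi : i < n) (w : FreeGroup ℕ) :
    FreeGroup.lift (freeSeq n s τ) (artinAut i w) =
      s i * FreeGroup.lift (freeSeq n s τ) w * (s i)⁻¹ := by
  have : (FreeGroup.lift (freeSeq n s τ)).comp (artinAut i).toMonoidHom =
      (MulAut.conj (s i)).toMonoidHom.comp (FreeGroup.lift (freeSeq n s τ)) := by
    refine FreeGroup.ext_hom _ _ fun j => ?_
    change FreeGroup.lift (freeSeq n s τ) (artinAut i (.of j)) =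
      s i * FreeGroup.lift (freeSeq n s τ) (.of j) * (s i)⁻¹
    by_cases h : j = i
    · rw [h, artinAut_of_self, FreeGroup.lift_apply_of, FreeGroup.lift_apply_of, freeSeq_succ hi]
    by_cases h' : j = i + 1
    · rw [h', artinAut_of_succ]
      simp only [map_mul, map_inv, FreeGroup.lift_apply_of]
      have hc := (commute_freeSeq_mul hs hτ hτ' hi).eq
      rw [eq_mul_inv_iff_mul_eq, mul_assoc, mul_assoc, inv_mul_eq_iff_eq_mul, ← mul_assoc, ← hc,
        freeSeq_succ hi]
      group
    · rw [artinAut_of_ne h h', FreeGroup.lift_apply_of, (commute_freeSeq_of_ne hs hτ hi h h').eq,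
        mul_inv_cancel_right]
  exact DFunLike.congr_fun this w

/-- A braid sequence together with a rotating element determine a representation of the semidirect
product. -/
theorem exists_hom_artinSemidirect (hs : IsBraidSeq n s)
    (hτ : ∀ i, i + 1 < n → τ * s i = s (i + 1) * τ) (hτ' : τ ^ 2 * s (n - 1) = s 0 * τ ^ 2) :
    ∃ f : ArtinSemidirect n →* H, (∀ i < n, f (ArtinSemidirect.sigma n i) = s i) ∧
      f (ArtinSemidirect.rot n) = τ := by
  let p := ArtinGroup.lift (fun i : Fin n => s i) hs.pathGraph_braid hs.pathGraph_comm
  have hp : ∀ g w, FreeGroup.lift (freeSeq n s τ) (artinRep n g w) =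
      p g * FreeGroup.lift (freeSeq n s τ) w * (p g)⁻¹ := fun g => by
    have hg : g ∈ Subgroup.closure (Set.range (ArtinGroup.gen (SimpleGraph.pathGraph n))) := by
      rw [show Subgroup.closure _ = ⊤ from PresentedGroup.closure_range_of _]
      trivial
    induction hg using Subgroup.closure_induction with
    | mem x hx =>
      obtain ⟨i, rfl⟩ := hx
      intro w
      rw [artinRep, ArtinGroup.lift_gen, lift_freeSeq_artinAut hs hτ hτ' i.2]
      simp only [p, ArtinGroup.lift_gen]
    | one => simp
    | mul x y _ _ hx hy =>
      intro w
      rw [map_mul, MulAut.mul_apply, hx, hy, map_mul]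
      group
    | inv x _ hx =>
      intro w
      have := hx (artinRep n x⁻¹ w)
      rw [← MulAut.mul_apply, ← map_mul, mul_inv_cancel, map_one, MulAut.one_apply] at this
      rw [this, map_inv p]
      group
  refine ⟨SemidirectProduct.lift (FreeGroup.lift (freeSeq n s τ)) p fun g =>
    MonoidHom.ext fun w => hp g w, ?_⟩
  have hσ : ∀ i < n, SemidirectProduct.lift (FreeGroup.lift (freeSeq n s τ)) p
      (fun g => MonoidHom.ext fun w => hp g w) (ArtinSemidirect.sigma n i) = s i := fun i hi => by
    rw [ArtinSemidirect.sigma, SemidirectProduct.lift_inr, natExtend_of_lt _ hi]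
    simp only [p, ArtinGroup.lift_gen]
  refine ⟨hσ, ?_⟩
  rw [ArtinSemidirect.rot, map_mul, map_rangeProd, ArtinSemidirect.x, SemidirectProduct.lift_inl,
    FreeGroup.lift_apply_of, freeSeq_zero, rangeProd_congr hσ, inv_mul_cancel_right]

end FreeSeq

theorem ArtinAtilde.exists_injective {n : ℕ} (hn : 2 ≤ n) :
    ∃ f : ArtinAtilde n →* ArtinSemidirect n, Function.Injective f := by
  obtain ⟨f, hf⟩ := exists_hom_of_shift hn (ArtinSemidirect.isBraidSeq_sigma n)
    (fun i hi => ArtinSemidirect.rot_mul_sigma hi) (ArtinSemidirect.rot_sq_mul_sigma (by omega))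
  obtain ⟨p, hp, hp'⟩ := exists_hom_artinSemidirect (Holomorph.isBraidSeq_t n)
    (fun i _ => Holomorph.tau_mul_t i) (Holomorph.tau_sq_mul_t (by omega))
  have h : p.comp f = SemidirectProduct.inl := PresentedGroup.ext fun i => by
    change p (f (gen n i)) = _
    rw [hf, map_mul, map_mul, map_inv, map_pow, hp', hp 0 (by omega), Holomorph.tau_pow_mul_t,
      Holomorph.t, ZMod.natCast_zmod_val]
  refine ⟨f, Function.Injective.of_comp (f := p) ?_⟩
  rw [← MonoidHom.coe_comp, h]
  exact SemidirectProduct.inl_injective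

/-- the euclidean Artin group `Art(Ã_n)` (`n ≥ 2`) is torsion-free:
its only element of finite order is the identity. -/
theorem artinAtilde_torsionFree (n : ℕ) (hn : 2 ≤ n) :
    ∀ g : PresentedGroup (relsArtinAtilde n), IsOfFinOrder g → g = 1 := by
  intro g hg
  obtain ⟨k, hk, hgk⟩ := isOfFinOrder_iff_pow_eq_one.1 hg
  obtain ⟨f, hf⟩ := ArtinAtilde.exists_injective hn
  refine hf ?_
  rw [map_one]
  exact ArtinSemidirect.eq_one_of_pow_eq_one hk (by rw [← map_pow, hgk, map_one])
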